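/- arXiv:2211.08019 — 5 statements merged into one kernel-verified Lean document; each statement's English description precedes it below -/
import Mathlib

section
/- Let (a,b) ∈ ℂ² \ {(0,0)} and let k ≥ 0 be an integer. For every integer p with 0 ≤ p ≤ k and every point z ∈ ℂ², the directional derivative of φ_p along Y₃ satisfies Y₃(φ_p)(z) = i·p·φ_{p−1}(z) + i·(k−p)·φ_{p+1}(z). -/
open Complex

noncomputable section

/-- The vector field `Y₂(z₁,z₂) = (i z₁, i z₂)` on `ℂ²`. -/
def Y2 (z : ℂ × ℂ) : ℂ × ℂ := (I * z.1, I * z.2)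

/-- The vector field `Y₃(z₁,z₂) = (-i conj z₂, i conj z₁)` on `ℂ²`. -/
def Y3 (z : ℂ × ℂ) : ℂ × ℂ := (-I * (starRingEnd ℂ) z.2, I * (starRingEnd ℂ) z.1)

/-- The vector field `Y₄(z₁,z₂) = (conj z₂, -conj z₁)` on `ℂ²`. -/
def Y4 (z : ℂ × ℂ) : ℂ × ℂ := ((starRingEnd ℂ) z.2, -(starRingEnd ℂ) z.1)

/-- Real Fréchet directional derivative of `f` along the vector field `X`. -/
def YD (X : ℂ × ℂ → ℂ × ℂ) (f : ℂ × ℂ → ℂ) : ℂ × ℂ → ℂ :=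
  fun z => fderiv ℝ f z (X z)

/-- `u(z₁,z₂) = a z₁ + b z₂`. -/
def uF (a b : ℂ) (z : ℂ × ℂ) : ℂ := a * z.1 + b * z.2

/-- `v(z₁,z₂) = b conj z₁ - a conj z₂`. -/
def vF (a b : ℂ) (z : ℂ × ℂ) : ℂ :=
  b * (starRingEnd ℂ) z.1 - a * (starRingEnd ℂ) z.2

/-- `φ_p = uᵖ v^(k-p)` for `0 ≤ p ≤ k`, and `0` otherwise. -/
def phi (a b : ℂ) (k p : ℤ) : ℂ × ℂ → ℂ :=
  fun z => if 0 ≤ p ∧ p ≤ k then uF a b z ^ p.toNat * vF a b z ^ (k - p).toNat else 0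

/-- `Y₃(φ_p) = i p φ_{p-1} + i (k - p) φ_{p+1}`. -/
theorem Y3_phi (a b : ℂ) (hab : (a, b) ≠ (0, 0)) (k p : ℤ) (hk : 0 ≤ k)
    (hp0 : 0 ≤ p) (hpk : p ≤ k) (z : ℂ × ℂ) :
    YD Y3 (phi a b k p) z =
      I * (p : ℂ) * phi a b k (p - 1) z + I * ((k - p : ℤ) : ℂ) * phi a b k (p + 1) z := by
  obtain ⟨m, rfl⟩ := Int.eq_ofNat_of_zero_le hp0
  obtain ⟨n, hn⟩ := Int.eq_ofNat_of_zero_le (sub_nonneg.2 hpk)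
  obtain rfl : k = m + n := by omega
  have hu : HasFDerivAt (uF a b)
      (a • ContinuousLinearMap.fst ℝ ℂ ℂ + b • ContinuousLinearMap.snd ℝ ℂ ℂ) z :=
    (a • ContinuousLinearMap.fst ℝ ℂ ℂ + b • ContinuousLinearMap.snd ℝ ℂ ℂ).hasFDerivAt
  have hv : HasFDerivAt (vF a b)
      (b • ((conjCLE : ℂ →L[ℝ] ℂ).comp (ContinuousLinearMap.fst ℝ ℂ ℂ))
        - a • ((conjCLE : ℂ →L[ℝ] ℂ).comp (ContinuousLinearMap.snd ℝ ℂ ℂ))) z :=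
    (b • ((conjCLE : ℂ →L[ℝ] ℂ).comp (ContinuousLinearMap.fst ℝ ℂ ℂ))
        - a • ((conjCLE : ℂ →L[ℝ] ℂ).comp (ContinuousLinearMap.snd ℝ ℂ ℂ))).hasFDerivAt
  have hphi : phi a b (m + n) m = fun z => uF a b z ^ m * vF a b z ^ n := by
    funext w
    simp [phi]
  have h := (hu.pow m).mul (hv.pow n)
  have h1 : (m : ℂ) * phi a b (m + n) (m - 1) z
      = m * uF a b z ^ (m - 1) * vF a b z ^ (n + 1) := by
    rcases m with _ | m
    · simp
    · have e : ((m + 1 : ℕ) + n - ((m + 1 : ℕ) - 1) : ℤ).toNat = n + 1 := by omega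
      have e2 : (((m + 1 : ℕ) : ℤ) - 1).toNat = m := by omega
      have c : (0 : ℤ) ≤ ((m + 1 : ℕ) : ℤ) - 1 ∧
        ((m + 1 : ℕ) : ℤ) - 1 ≤ ((m + 1 : ℕ) : ℤ) + n := by omega
      unfold phi
      rw [if_pos c, e, e2, Nat.add_sub_cancel, mul_assoc]
  have h2 : (n : ℂ) * phi a b (m + n) (m + 1) z
      = n * uF a b z ^ (m + 1) * vF a b z ^ (n - 1) := by
    rcases n with _ | n
    · simp
    · have e : (m + (n + 1 : ℕ) - (m + 1) : ℤ).toNat = n := by omega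
      have e2 : ((m : ℤ) + 1).toNat = m + 1 := by omega
      have c : (0 : ℤ) ≤ (m : ℤ) + 1 ∧ (m : ℤ) + 1 ≤ m + (n + 1 : ℕ) := by omega
      unfold phi
      rw [if_pos c, e, e2, Nat.add_sub_cancel, mul_assoc]
  have h3 : a * (-I * (starRingEnd ℂ) z.2) + b * (I * (starRingEnd ℂ) z.1) = I * vF a b z := by
    unfold vF; ring
  have h4 : b * (I * z.2) + a * (I * z.1) = I * uF a b z := by
    unfold uF; ring
  have hnn : (((m : ℤ) + n - m : ℤ) : ℂ) = n := by push_cast; ring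
  rw [hnn, Int.cast_natCast, mul_assoc, h1, mul_assoc I (n : ℂ), h2]
  unfold YD
  rw [hphi]
  have hf := h.fderiv
  have key : fderiv ℝ (fun z => uF a b z ^ m * vF a b z ^ n) z (Y3 z)
     = uF a b z ^ m * (n * vF a b z ^ (n - 1) * (I * uF a b z))
       + vF a b z ^ n * (m * uF a b z ^ (m - 1) * (I * vF a b z)) := by
    rw [← h3, ← h4]
    refine (congrArg (fun L => L (Y3 z)) hf).trans ?_
    simp [Y3]
    ring
  rw [key]
  ring
end
end

section
/- Let (a,b) ∈ ℂ² \ {(0,0)} and let k ≥ 0 be an integer. For every integer p with 0 ≤ p ≤ k and every point z ∈ ℂ², the directional derivative of φ_p along Y₄ satisfies Y₄(φ_p)(z) = −p·φ_{p−1}(z) + (k−p)·φ_{p+1}(z). -/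
open Complex

noncomputable section

/-- The real derivative of `u`. -/
def uL (a b : ℂ) : ℂ × ℂ →L[ℝ] ℂ :=
  a • ContinuousLinearMap.fst ℝ ℂ ℂ + b • ContinuousLinearMap.snd ℝ ℂ ℂ

/-- The real derivative of `v`. -/
def vL (a b : ℂ) : ℂ × ℂ →L[ℝ] ℂ :=
  b • ((conjCLE : ℂ →L[ℝ] ℂ).comp (ContinuousLinearMap.fst ℝ ℂ ℂ)) -
    a • ((conjCLE : ℂ →L[ℝ] ℂ).comp (ContinuousLinearMap.snd ℝ ℂ ℂ))

theorem uF_hasFDerivAt (a b : ℂ) (z : ℂ × ℂ) : HasFDerivAt (uF a b) (uL a b) z := by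
  have h : uF a b = fun z => uL a b z := by
    funext z; simp [uF, uL]
  rw [h]; exact (uL a b).hasFDerivAt

theorem vF_hasFDerivAt (a b : ℂ) (z : ℂ × ℂ) : HasFDerivAt (vF a b) (vL a b) z := by
  have h : vF a b = fun z => vL a b z := by
    funext z; simp [vF, vL]
  rw [h]; exact (vL a b).hasFDerivAt

theorem fderiv_uv (a b : ℂ) (m n : ℕ) (z : ℂ × ℂ) :
    fderiv ℝ (fun z => uF a b z ^ m * vF a b z ^ n) z (Y4 z) =
      -(m : ℂ) * (uF a b z ^ (m - 1) * vF a b z ^ (n + 1)) +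
        (n : ℂ) * (uF a b z ^ (m + 1) * vF a b z ^ (n - 1)) := by
  have h := ((uF_hasFDerivAt a b z).pow m).mul ((vF_hasFDerivAt a b z).pow n)
  have hu : uL a b (Y4 z) = - vF a b z := by
    simp [uL, Y4, vF]; ring
  have hv : vL a b (Y4 z) = uF a b z := by
    simp [vL, Y4, uF]; ring
  have h2 := congrArg (fun L : ℂ × ℂ →L[ℝ] ℂ => L (Y4 z)) h.fderiv
  refine Eq.trans h2 ?_
  simp [hu, hv]
  ring

/-- `Y₄(φ_p) = -p φ_{p-1} + (k - p) φ_{p+1}`. -/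
theorem Y4_phi (a b : ℂ) (hab : (a, b) ≠ (0, 0)) (k p : ℤ) (hk : 0 ≤ k)
    (hp0 : 0 ≤ p) (hpk : p ≤ k) (z : ℂ × ℂ) :
    YD Y4 (phi a b k p) z =
      -(p : ℂ) * phi a b k (p - 1) z + ((k - p : ℤ) : ℂ) * phi a b k (p + 1) z := by
  obtain ⟨m, rfl⟩ := Int.eq_ofNat_of_zero_le hp0
  obtain ⟨n, hn⟩ := Int.eq_ofNat_of_zero_le (sub_nonneg.mpr hpk)
  obtain rfl : k = m + n := by omega
  have h1 : phi a b ((m : ℤ) + n) m = fun z => uF a b z ^ m * vF a b z ^ n := by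
    funext z; simp [phi]
  have h2 : (m : ℂ) * phi a b ((m : ℤ) + n) (m - 1) z =
      m * (uF a b z ^ (m - 1) * vF a b z ^ (n + 1)) := by
    rcases m with _ | m
    · simp
    · have e1 : (((m + 1 : ℕ) : ℤ) - 1).toNat = m := by omega
      have e2 : (((m + 1 : ℕ) : ℤ) + n - (((m + 1 : ℕ) : ℤ) - 1)).toNat = n + 1 := by omega
      unfold phi
      rw [if_pos (by omega), e1, e2, Nat.add_sub_cancel]
  have h3 : (n : ℂ) * phi a b ((m : ℤ) + n) (m + 1) z =
      n * (uF a b z ^ (m + 1) * vF a b z ^ (n - 1)) := by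
    rcases n with _ | n
    · simp
    · have e1 : ((m : ℤ) + 1).toNat = m + 1 := by omega
      have e2 : ((m : ℤ) + ((n + 1 : ℕ) : ℤ) - ((m : ℤ) + 1)).toNat = n := by omega
      unfold phi
      rw [if_pos (by omega), e1, e2, Nat.add_sub_cancel]
  have e : (((m : ℤ) + n - m : ℤ) : ℂ) = n := by push_cast; ring
  rw [e, h3]
  unfold YD
  rw [h1, fderiv_uv, Int.cast_natCast, neg_mul, neg_mul, h2]
end
end

section
/- Let (a,b) ∈ ℂ² \ {(0,0)} and let k ≥ 0 be an integer. For every integer p with 0 ≤ p ≤ k and every point z ∈ ℂ², one has −(Y₂²φ_p)(z) − (Y₃²φ_p)(z) − (Y₄²φ_p)(z) = k(k+2)·φ_p(z). In particular, the restriction of φ_p to the unit sphere S³ ⊂ ℂ² is an eigenfunction of the Laplacian Δ^{S³} = −(Y₂² + Y₃² + Y₄²) of the round metric of curvature 1 with eigenvalue k(k+2). -/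
open Complex

noncomputable section

/-- Derivative of `u`. -/
theorem hasFDerivAt_uF (a b : ℂ) (z : ℂ × ℂ) :
    ∃ L : ℂ × ℂ →L[ℝ] ℂ, HasFDerivAt (uF a b) L z ∧ ∀ w, L w = uF a b w := by
  let L : ℂ × ℂ →L[ℝ] ℂ := a • ContinuousLinearMap.fst ℝ ℂ ℂ + b • ContinuousLinearMap.snd ℝ ℂ ℂ
  have hL : ∀ w, L w = uF a b w := fun w => by simp [L, uF]
  refine ⟨L, ?_, hL⟩
  have h := L.hasFDerivAt (x := z)
  rwa [show (L : ℂ × ℂ → ℂ) = uF a b from funext hL] at h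

/-- Derivative of `v`. -/
theorem hasFDerivAt_vF (a b : ℂ) (z : ℂ × ℂ) :
    ∃ L : ℂ × ℂ →L[ℝ] ℂ, HasFDerivAt (vF a b) L z ∧ ∀ w, L w = vF a b w := by
  let L : ℂ × ℂ →L[ℝ] ℂ :=
    b • ((conjCLE : ℂ →L[ℝ] ℂ).comp (ContinuousLinearMap.fst ℝ ℂ ℂ))
      - a • ((conjCLE : ℂ →L[ℝ] ℂ).comp (ContinuousLinearMap.snd ℝ ℂ ℂ))
  have hL : ∀ w, L w = vF a b w := fun w => by simp [L, vF]
  refine ⟨L, ?_, hL⟩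
  have h := L.hasFDerivAt (x := z)
  rwa [show (L : ℂ × ℂ → ℂ) = vF a b from funext hL] at h

/-- Derivative of a combination of two monomials in `u`, `v`. -/
theorem YD_comb (X : ℂ × ℂ → ℂ × ℂ) (a b c d : ℂ) (n m nn mm : ℕ) :
    YD X (fun z => c * (uF a b z ^ n * vF a b z ^ m) + d * (uF a b z ^ nn * vF a b z ^ mm)) =
    fun z => c * (n * uF a b z ^ (n - 1) * vF a b z ^ m * uF a b (X z)
        + m * uF a b z ^ n * vF a b z ^ (m - 1) * vF a b (X z))
      + d * (nn * uF a b z ^ (nn - 1) * vF a b z ^ mm * uF a b (X z)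
        + mm * uF a b z ^ nn * vF a b z ^ (mm - 1) * vF a b (X z)) := by
  funext z
  obtain ⟨L, hu, hL⟩ := hasFDerivAt_uF a b z
  obtain ⟨M, hv, hM⟩ := hasFDerivAt_vF a b z
  have h := (((hu.pow n).mul (hv.pow m)).const_mul c).add
    (((hu.pow nn).mul (hv.pow mm)).const_mul d)
  have h2 := h.fderiv
  unfold YD
  refine (congrArg (fun T : ℂ × ℂ →L[ℝ] ℂ => T (X z)) h2).trans ?_
  simp [hL, hM]
  ring

theorem uF_Y2 (a b : ℂ) (z : ℂ × ℂ) : uF a b (Y2 z) = I * uF a b z := by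
  simp [uF, Y2]; ring

theorem vF_Y2 (a b : ℂ) (z : ℂ × ℂ) : vF a b (Y2 z) = -I * vF a b z := by
  simp [vF, Y2]; ring

theorem uF_Y3 (a b : ℂ) (z : ℂ × ℂ) : uF a b (Y3 z) = I * vF a b z := by
  simp [uF, vF, Y3]; ring

theorem vF_Y3 (a b : ℂ) (z : ℂ × ℂ) : vF a b (Y3 z) = I * uF a b z := by
  simp [uF, vF, Y3]; ring

theorem uF_Y4 (a b : ℂ) (z : ℂ × ℂ) : uF a b (Y4 z) = -vF a b z := by
  simp [uF, vF, Y4]; ring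

theorem vF_Y4 (a b : ℂ) (z : ℂ × ℂ) : vF a b (Y4 z) = uF a b z := by
  simp [uF, vF, Y4]; ring

theorem YD_mono (X : ℂ × ℂ → ℂ × ℂ) (a b : ℂ) (n m : ℕ) :
    YD X (fun z => uF a b z ^ n * vF a b z ^ m) =
    fun z => n * uF a b z ^ (n - 1) * vF a b z ^ m * uF a b (X z)
        + m * uF a b z ^ n * vF a b z ^ (m - 1) * vF a b (X z) := by
  have h := YD_comb X a b 1 0 n m 0 0
  simpa using h

theorem YD2_mono (a b : ℂ) (n m : ℕ) :
    YD Y2 (fun z => uF a b z ^ n * vF a b z ^ m) =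
    fun z => (I * (n - m)) * (uF a b z ^ n * vF a b z ^ m)
      + 0 * (uF a b z ^ 0 * vF a b z ^ 0) := by
  rw [YD_mono]
  funext z
  rw [uF_Y2, vF_Y2]
  rcases n with _ | n <;> rcases m with _ | m <;> simp <;> ring

theorem YD3_mono (a b : ℂ) (n m : ℕ) :
    YD Y3 (fun z => uF a b z ^ n * vF a b z ^ m) =
    fun z => (I * n) * (uF a b z ^ (n - 1) * vF a b z ^ (m + 1))
      + (I * m) * (uF a b z ^ (n + 1) * vF a b z ^ (m - 1)) := by
  rw [YD_mono]
  funext z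
  rw [uF_Y3, vF_Y3]
  ring

theorem YD4_mono (a b : ℂ) (n m : ℕ) :
    YD Y4 (fun z => uF a b z ^ n * vF a b z ^ m) =
    fun z => (-n) * (uF a b z ^ (n - 1) * vF a b z ^ (m + 1))
      + m * (uF a b z ^ (n + 1) * vF a b z ^ (m - 1)) := by
  rw [YD_mono]
  funext z
  rw [uF_Y4, vF_Y4]
  ring

theorem laplacian_mono (a b : ℂ) (n m : ℕ) (z : ℂ × ℂ) :
    -YD Y2 (YD Y2 (fun z => uF a b z ^ n * vF a b z ^ m)) z
      - YD Y3 (YD Y3 (fun z => uF a b z ^ n * vF a b z ^ m)) z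
      - YD Y4 (YD Y4 (fun z => uF a b z ^ n * vF a b z ^ m)) z
      = (((n : ℂ) + m) * (n + m + 2)) * (uF a b z ^ n * vF a b z ^ m) := by
  rw [YD2_mono, YD3_mono, YD4_mono, YD_comb, YD_comb, YD_comb]
  simp only [uF_Y2, vF_Y2, uF_Y3, vF_Y3, uF_Y4, vF_Y4]
  generalize uF a b z = u
  generalize vF a b z = v
  have hI : I ^ 2 = -1 := I_sq
  rcases n with _ | _ | n <;> rcases m with _ | _ | m <;> simp <;> ring_nf <;>
    simp only [hI] <;> ring

/-- `-(Y₂² + Y₃² + Y₄²)(φ_p) = k (k + 2) φ_p`: the spherical harmonic `φ_p` is an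
eigenfunction of the round Laplacian `Δ^{S³} = -(Y₂² + Y₃² + Y₄²)` with eigenvalue `k(k+2)`. -/
theorem laplacian_phi (a b : ℂ) (hab : (a, b) ≠ (0, 0)) (k p : ℤ) (hk : 0 ≤ k)
    (hp0 : 0 ≤ p) (hpk : p ≤ k) (z : ℂ × ℂ) :
    -YD Y2 (YD Y2 (phi a b k p)) z - YD Y3 (YD Y3 (phi a b k p)) z
      - YD Y4 (YD Y4 (phi a b k p)) z = ((k * (k + 2) : ℤ) : ℂ) * phi a b k p z := by
  obtain ⟨n, rfl⟩ := Int.eq_ofNat_of_zero_le hp0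
  obtain ⟨m, hm⟩ := Int.eq_ofNat_of_zero_le (sub_nonneg.mpr hpk)
  obtain rfl : k = n + m := by omega
  have h : phi a b (n + m) n = fun z => uF a b z ^ n * vF a b z ^ m := by
    funext w
    simp [phi]
  rw [h, laplacian_mono]
  push_cast
  ring
end
end

section
/- Let ε > 0 and for integers k ≥ 0 and 0 ≤ p ≤ k define λ(k,p) = k(k+2) + (ε⁻² − 1)(2p−k)². Then the minimum of λ(k,p) over all pairs (k,p) with k ≥ 1 and 0 ≤ p ≤ k equals 8 if 0 < ε ≤ 1/√6, and equals 2 + ε⁻² if ε > 1/√6. (That is, the first non-zero eigenvalue of the Laplacian on the Berger sphere (S³, g_ε) is 8 if ε ≤ 1/√6 and 2 + ε⁻² if ε > 1/√6.) -/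
/-- The first non-zero eigenvalue of the Laplacian on the Berger sphere `(S³, g_ε)`:
the minimum of `λ(k,p) = k(k+2) + (ε⁻² - 1)(2p - k)²` over integer pairs with
`k ≥ 1`, `0 ≤ p ≤ k`, equals `8` if `0 < ε ≤ 1/√6` and `2 + ε⁻²` if `ε > 1/√6`. -/
theorem berger_first_nonzero_eigenvalue (ε : ℝ) (hε : 0 < ε) :
    (ε ≤ 1 / Real.sqrt 6 →
      IsLeast {x : ℝ | ∃ k p : ℤ, 1 ≤ k ∧ 0 ≤ p ∧ p ≤ k ∧
        x = ((k * (k + 2) : ℤ) : ℝ) + ((ε ^ 2)⁻¹ - 1) * ((2 * p - k : ℤ) : ℝ) ^ 2} 8) ∧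
    (1 / Real.sqrt 6 < ε →
      IsLeast {x : ℝ | ∃ k p : ℤ, 1 ≤ k ∧ 0 ≤ p ∧ p ≤ k ∧
        x = ((k * (k + 2) : ℤ) : ℝ) + ((ε ^ 2)⁻¹ - 1) * ((2 * p - k : ℤ) : ℝ) ^ 2}
        (2 + (ε ^ 2)⁻¹)) := by
  have ht : 0 < (ε ^ 2)⁻¹ := by positivity
  have h6 : (0 : ℝ) < Real.sqrt 6 := by positivity
  have hs : Real.sqrt 6 ^ 2 = 6 := Real.sq_sqrt (by norm_num)
  have he : (ε ^ 2)⁻¹ * ε ^ 2 = 1 := inv_mul_cancel₀ (by positivity)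
  have hk1 : ∀ k p : ℤ, 1 ≤ k → 0 ≤ p → p ≤ k → ¬ 2 ≤ k → (2 * p - k) ^ 2 = 1 ∧ k = 1 := by
    intro k p h1 h2 h3 h4
    obtain rfl : k = 1 := by omega
    have : p = 0 ∨ p = 1 := by omega
    rcases this with rfl | rfl <;> norm_num
  constructor
  · intro h
    have h6t : 6 ≤ (ε ^ 2)⁻¹ := by
      rw [le_div_iff₀ h6] at h
      have h2 : ε ^ 2 * 6 ≤ 1 := by
        rw [← hs, ← mul_pow]
        exact pow_le_one₀ (by positivity) h
      rw [le_inv_comm₀ (by norm_num) (by positivity)]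
      linarith
    generalize (ε ^ 2)⁻¹ = t at *
    refine ⟨⟨2, 1, by norm_num, by norm_num, by norm_num, by norm_num⟩, ?_⟩
    rintro x ⟨k, p, hk, hp, hpk, rfl⟩
    by_cases hk2 : 2 ≤ k
    · have a : ((8 : ℤ) : ℝ) ≤ ((k * (k + 2) : ℤ) : ℝ) := by
        exact_mod_cast (by nlinarith : (8 : ℤ) ≤ k * (k + 2))
      have b : 0 ≤ (t - 1) * ((2 * p - k : ℤ) : ℝ) ^ 2 :=
        mul_nonneg (by linarith) (sq_nonneg _)
      push_cast at a b ⊢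
      linarith
    · obtain ⟨hm, rfl⟩ := hk1 k p hk hp hpk hk2
      rw [← Int.cast_pow, hm]
      norm_num
      linarith
  · intro h
    have h6t : (ε ^ 2)⁻¹ < 6 := by
      rw [div_lt_iff₀ h6] at h
      have h2 : 1 < ε ^ 2 * 6 := by
        rw [← hs, ← mul_pow]
        exact one_lt_pow₀ h (by norm_num)
      rw [inv_lt_comm₀ (by positivity) (by norm_num)]
      linarith
    generalize (ε ^ 2)⁻¹ = t at *
    refine ⟨⟨1, 1, by norm_num, by norm_num, by norm_num, by norm_num; ring⟩, ?_⟩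
    rintro x ⟨k, p, hk, hp, hpk, rfl⟩
    by_cases hk2 : 2 ≤ k
    · have hmk : (2 * p - k) ^ 2 ≤ k ^ 2 := by nlinarith
      by_cases hm : 2 * p - k = 0
      · have a : ((8 : ℤ) : ℝ) ≤ ((k * (k + 2) : ℤ) : ℝ) := by
          exact_mod_cast (by nlinarith : (8 : ℤ) ≤ k * (k + 2))
        rw [hm]
        push_cast at a ⊢
        linarith
      · have hm1 : 1 ≤ (2 * p - k) ^ 2 := by
          have : 0 < (2 * p - k) ^ 2 := by positivity
          omega
        generalize 2 * p - k = m at *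
        have a : (m : ℝ) ^ 2 ≤ (k : ℝ) ^ 2 := by exact_mod_cast hmk
        have b : (1 : ℝ) ≤ (m : ℝ) ^ 2 := by exact_mod_cast hm1
        have c : (2 : ℝ) ≤ k := by exact_mod_cast hk2
        push_cast
        nlinarith [mul_le_mul_of_nonneg_left b ht.le]
    · obtain ⟨hm, rfl⟩ := hk1 k p hk hp hpk hk2
      rw [← Int.cast_pow, hm]
      norm_num
      linarith
end

section
/- For every real number t with 0 ≤ t ≤ √3/(√3 + 2√2), the quantity D(t) := (1−t)² − (8/3)t² is nonnegative, and the following inequalities hold: t² ≤ (3/2)·[(1−t) − √(D(t))] and (3/2)·[(1−t) + √(D(t))] ≤ 3 − 2t + t². (This verifies, for the unit sphere S³ with magnetic potential α = t·Y₂ where λ₁^α = t² and λ₂^α = 3 − 2t + t², the Lichnerowicz-type bounds λ₁^α ≤ a₋(2, 2t, 3) and λ₂^α ≥ a₊(2, 2t, 3).) -/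
/-- Verification of the Lichnerowicz-type bounds for the unit `S³` with magnetic potential
`α = t Y₂`: for `0 ≤ t ≤ √3/(√3 + 2√2)` the discriminant `D(t) = (1-t)² - (8/3)t²` is
nonnegative, `λ₁^α = t² ≤ a₋(2,2t,3) = (3/2)[(1-t) - √(D(t))]`, and
`a₊(2,2t,3) = (3/2)[(1-t) + √(D(t))] ≤ 3 - 2t + t² = λ₂^α`. -/
theorem lichnerowicz_bounds_sphere (t : ℝ) (h0 : 0 ≤ t)
    (h1 : t ≤ Real.sqrt 3 / (Real.sqrt 3 + 2 * Real.sqrt 2)) :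
    0 ≤ (1 - t) ^ 2 - (8 / 3) * t ^ 2 ∧
    t ^ 2 ≤ (3 / 2) * ((1 - t) - Real.sqrt ((1 - t) ^ 2 - (8 / 3) * t ^ 2)) ∧
    (3 / 2) * ((1 - t) + Real.sqrt ((1 - t) ^ 2 - (8 / 3) * t ^ 2)) ≤ 3 - 2 * t + t ^ 2 := by
  have h3 : 0 < Real.sqrt 3 := Real.sqrt_pos.mpr (by norm_num)
  have h2 : 0 < Real.sqrt 2 := Real.sqrt_pos.mpr (by norm_num)
  have q3 : Real.sqrt 3 ^ 2 = 3 := Real.sq_sqrt (by norm_num)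
  have q2 : Real.sqrt 2 ^ 2 = 2 := Real.sq_sqrt (by norm_num)
  rw [le_div_iff₀ (by positivity)] at h1
  have hk : t * (2 * Real.sqrt 2) ≤ Real.sqrt 3 * (1 - t) := by linarith
  have hp : 0 ≤ t * (2 * Real.sqrt 2) := by positivity
  have ht1 : 0 ≤ 1 - t := nonneg_of_mul_nonneg_right (hp.trans hk) h3
  have hsq := pow_le_pow_left₀ hp hk 2
  have e1 : (t * (2 * Real.sqrt 2)) ^ 2 = 8 * t ^ 2 := by
    rw [mul_pow, mul_pow, q2]; ring
  have e2 : (Real.sqrt 3 * (1 - t)) ^ 2 = 3 * (1 - t) ^ 2 := by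
    rw [mul_pow, q3]
  rw [e1, e2] at hsq
  have ht2 : t ≤ 1 / 2 := by
    by_contra hc
    push Not at hc
    nlinarith
  have hs : Real.sqrt ((1 - t) ^ 2 - (8 / 3) * t ^ 2) ≤ (1 - t) - 2 / 3 * t ^ 2 := by
    apply Real.sqrt_le_iff.mpr
    constructor
    · nlinarith
    · have a : 0 ≤ t ^ 3 := by positivity
      have b : 0 ≤ t ^ 4 := by positivity
      have c : 0 ≤ t ^ 2 := by positivity
      nlinarith
  refine ⟨by linarith, by linarith, ?_⟩
  nlinarith [sq_nonneg t]
end
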